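/- There exists a constant C > 0 such that for every finite non-piercing family ℱ of regions in the plane in general position, the transversal number satisfies τ(ℱ) ≤ C · ν(ℱ)^11, where ν(ℱ) is the matching number of ℱ. -/

import Mathlib

open Set

/-- The plane ℝ². -/
abbrev Plane := ℝ × ℝ

/-- A Jordan curve: the image of a continuous injective map from the unit circle into ℝ². -/
def IsJordanCurve (S : Set Plane) : Prop :=
  ∃ f : Circle → Plane, Continuous f ∧ Function.Injective f ∧ Set.range f = S

/-- A region: a compact, connected subset of ℝ² whose frontier is the union of
finitely many pairwise disjoint Jordan curves. -/
def IsRegion (F : Set Plane) : Prop :=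
  IsCompact F ∧ IsConnected F ∧
    ∃ (n : ℕ) (γ : Fin n → Set Plane), (∀ i, IsJordanCurve (γ i)) ∧
      (Pairwise fun i j => Disjoint (γ i) (γ j)) ∧ frontier F = ⋃ i, γ i

/-- A family of regions is in general position if the frontiers of any two of its
members intersect in only finitely many points. -/
def GeneralPosition (ℱ : Set (Set Plane)) : Prop :=
  ∀ F ∈ ℱ, ∀ G ∈ ℱ, F ≠ G → (frontier F ∩ frontier G).Finite

/-- A family is non-piercing if the difference of any two of its members is connected. -/
def NonPiercing (ℱ : Set (Set Plane)) : Prop :=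
  ∀ F ∈ ℱ, ∀ G ∈ ℱ, F ≠ G → IsConnected (F \ G)

/-- The transversal number: the smallest cardinality of a set of points of the plane
meeting every member of the family. -/
noncomputable def transversalNumber (ℱ : Set (Set Plane)) : ℕ :=
  sInf {n | ∃ T : Finset Plane, T.card = n ∧ ∀ F ∈ ℱ, ∃ p ∈ T, p ∈ F}

/-- The matching number: the maximum number of pairwise disjoint members of the family. -/
noncomputable def matchingNumber (ℱ : Set (Set Plane)) : ℕ :=
  sSup {n | ∃ 𝒢 : Finset (Set Plane), ↑𝒢 ⊆ ℱ ∧ 𝒢.card = n ∧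
    (𝒢 : Set (Set Plane)).Pairwise Disjoint}

/-! ### Discrete winding numbers -/

/-- The principal change of the argument, seen from `v`, when moving from `x` to `y`. -/
noncomputable def stepTurn (x y v : ℂ) : ℝ :=
  ((Complex.arg (y - v) : Real.Angle) - (Complex.arg (x - v) : Real.Angle)).toReal

/-- A source, a target, and for each point a real lift of the change of the argument
seen from that point. -/
structure AnglePath where
  /-- The starting point. -/
  src : ℂ
  /-- The end point. -/
  tgt : ℂ
  /-- The total change of the argument as seen from a point. -/
  turn : ℂ → ℝ
  coe_turn : ∀ v, (turn v : Real.Angle) =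
    (Complex.arg (tgt - v) : Real.Angle) - (Complex.arg (src - v) : Real.Angle)

namespace AnglePath

/-- The constant path. -/
def const (a : ℂ) : AnglePath := ⟨a, a, fun _ => 0, fun v => by simp⟩

/-- Append a straight step to a path. -/
noncomputable def extend (e : AnglePath) (y : ℂ) : AnglePath :=
  ⟨e.src, y, fun v => e.turn v + stepTurn e.tgt y v, fun v => by
    rw [Real.Angle.coe_add, e.coe_turn, stepTurn, Real.Angle.coe_toReal]; abel⟩

/-- Follow `e`, then `f` backwards. -/
noncomputable def join (e f : AnglePath) (h : e.tgt = f.tgt) : AnglePath :=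
  ⟨e.src, f.src, fun v => e.turn v - f.turn v, fun v => by
    rw [Real.Angle.coe_sub, e.coe_turn, f.coe_turn, h]; abel⟩

/-- The algebraic crossing number of two paths, multiplied by `2π`. -/
noncomputable def crossing (e f : AnglePath) : ℝ :=
  e.turn f.src - e.turn f.tgt + f.turn e.tgt - f.turn e.src

theorem exists_turn_eq (e : AnglePath) (v : ℂ) : ∃ n : ℤ,
    e.turn v = Complex.arg (e.tgt - v) - Complex.arg (e.src - v) + 2 * Real.pi * n := by
  have h := e.coe_turn v
  rw [← Real.Angle.coe_sub, Real.Angle.angle_eq_iff_two_pi_dvd_sub] at h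
  obtain ⟨k, hk⟩ := h
  exact ⟨k, by linarith⟩

/-- A path made of steps related by `R`. -/
inductive IsStepPath (R : ℂ → ℂ → Prop) : AnglePath → Prop
  | const (a : ℂ) : IsStepPath R (AnglePath.const a)
  | extend {e : AnglePath} {y : ℂ} : IsStepPath R e → R e.tgt y → IsStepPath R (e.extend y)

end AnglePath

theorem exists_arg_sub_swap {x y : ℂ} (h : x ≠ y) : ∃ n : ℤ,
    Complex.arg (x - y) - Complex.arg (y - x) = Real.pi + 2 * Real.pi * n := by
  have h1 := Complex.arg_neg_coe_angle (sub_ne_zero.2 h.symm)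
  rw [neg_sub, ← Real.Angle.coe_add, Real.Angle.angle_eq_iff_two_pi_dvd_sub] at h1
  obtain ⟨k, hk⟩ := h1
  exact ⟨k, by linarith⟩

theorem abs_stepTurn_lt {x y v : ℂ} (h : dist x y < dist x v) :
    |stepTurn x y v| < Real.pi / 2 := by
  have hx : x - v ≠ 0 := by
    rw [sub_ne_zero]; rintro rfl; simp at h; exact absurd h (not_lt.2 dist_nonneg)
  have hy : y - v ≠ 0 := by
    rw [sub_ne_zero]; rintro rfl; exact lt_irrefl _ h
  have hre : 0 < ((y - v) / (x - v)).re := by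
    have h1 : (y - v) / (x - v) = 1 - (x - y) / (x - v) := by field_simp; ring
    have h2 : ‖(x - y) / (x - v)‖ < 1 := by
      rw [norm_div, div_lt_one (norm_pos_iff.2 hx), ← dist_eq_norm, ← dist_eq_norm]; exact h
    have h3 := (Complex.re_le_norm ((x - y) / (x - v))).trans_lt h2
    rw [h1, Complex.sub_re, Complex.one_re]; linarith
  rw [stepTurn, ← Complex.arg_div_coe_angle hy hx,
    Real.Angle.toReal_coe_eq_self_iff.2 ⟨Complex.neg_pi_lt_arg _, Complex.arg_le_pi _⟩]
  exact Complex.abs_arg_lt_pi_div_two_iff.2 (Or.inl hre)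

theorem Real.eq_zero_of_coe_angle_eq_zero {t : ℝ} (h : (t : Real.Angle) = 0)
    (ht : |t| < 2 * Real.pi) : t = 0 := by
  rw [← Real.Angle.coe_zero, Real.Angle.angle_eq_iff_two_pi_dvd_sub] at h
  obtain ⟨k, hk⟩ := h
  have hp := Real.pi_pos
  have hk0 : k = 0 := by
    rw [abs_lt] at ht
    have h1 : ((-1 : ℤ) : ℝ) < k := by push_cast; nlinarith
    have h2 : (k : ℝ) < (1 : ℤ) := by push_cast; nlinarith
    have := Int.cast_lt.1 h1
    have := Int.cast_lt.1 h2
    omega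
  rw [hk0] at hk; simpa using hk

theorem stepTurn_square {x x' y y' : ℂ} (h : dist x x' + dist y y' < dist x y) :
    stepTurn x x' y - stepTurn x x' y' + stepTurn y y' x' - stepTurn y y' x = 0 := by
  have n1 := dist_nonneg (x := x) (y := x')
  have n2 := dist_nonneg (x := y) (y := y')
  have t1 := dist_triangle_right x y y'
  have t2 := dist_triangle_right y x x'
  have t3 := dist_triangle4 x x' y' y
  rw [dist_comm y' y] at t3
  rw [dist_comm y x] at t2
  have b1 := abs_lt.1 (abs_stepTurn_lt (x := x) (y := x') (v := y) (by linarith))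
  have b2 := abs_lt.1 (abs_stepTurn_lt (x := x) (y := x') (v := y') (by linarith))
  have b3 := abs_lt.1 (abs_stepTurn_lt (x := y) (y := y') (v := x') (by linarith))
  have b4 := abs_lt.1 (abs_stepTurn_lt (x := y) (y := y') (v := x) (by
    rw [dist_comm y x]; linarith))
  have swap : ∀ {a b : ℂ}, 0 < dist a b → (Complex.arg (b - a) : Real.Angle) =
      Complex.arg (a - b) + Real.pi := fun {a b} hab => by
    rw [← neg_sub, Complex.arg_neg_coe_angle (sub_ne_zero.2 (dist_pos.1 hab))]
  refine Real.eq_zero_of_coe_angle_eq_zero ?_ (abs_lt.2 ⟨by linarith, by linarith⟩)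
  simp only [Real.Angle.coe_add, Real.Angle.coe_sub, stepTurn, Real.Angle.coe_toReal]
  rw [swap (show 0 < dist x y by linarith), swap (show 0 < dist x y' by linarith),
    swap (show 0 < dist x' y by rw [dist_comm]; linarith),
    swap (show 0 < dist x' y' by linarith)]
  abel

namespace AnglePath

theorem crossing_eq_zero_of_isStepPath {R S : ℂ → ℂ → Prop} {e f : AnglePath}
    (he : IsStepPath R e) (hf : IsStepPath S f)
    (h : ∀ x x' y y', R x x' → S y y' → dist x x' + dist y y' < dist x y) :
    crossing e f = 0 := by
  induction he with
  | const a => simp [crossing, AnglePath.const]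
  | @extend e x' _ hx ih =>
    have key : stepTurn e.tgt x' f.src - stepTurn e.tgt x' f.tgt + f.turn x' - f.turn e.tgt
        = 0 := by
      clear ih
      induction hf with
      | const a => simp [AnglePath.const]
      | @extend f y' _ hy ih =>
        have := stepTurn_square (h _ _ _ _ hx hy)
        simp only [AnglePath.extend] at *
        linarith
    simp only [crossing, AnglePath.extend] at *
    linarith

end AnglePath

/-- Steps inside `F` of length less than `δ`. -/
def FineStep (F : Set ℂ) (δ : ℝ) (x y : ℂ) : Prop := x ∈ F ∧ y ∈ F ∧ dist x y < δ

/-- Steps inside `F \ G` that are short compared to the distance from `G`. -/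
def AwayStep (F G : Set ℂ) (x y : ℂ) : Prop :=
  x ∈ F \ G ∧ y ∈ F \ G ∧ dist x y < Metric.infDist x G / 2

open AnglePath Filter Topology

theorem exists_isStepPath_of_isPreconnected {S : Set ℂ} (hS : IsPreconnected S)
    {R : ℂ → ℂ → Prop} (hR : ∀ x ∈ S, ∀ᶠ y in 𝓝[S] x, R x y ∧ R y x) {a b : ℂ}
    (ha : a ∈ S) (hb : b ∈ S) : ∃ e, IsStepPath R e ∧ e.src = a ∧ e.tgt = b := by
  have h : Relation.ReflTransGen R a b :=
    hS.induction₂' (Relation.ReflTransGen R)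
      (fun x hx => (hR x hx).mono fun y hy =>
        ⟨Relation.ReflTransGen.single hy.1, Relation.ReflTransGen.single hy.2⟩)
      (fun _ _ _ _ _ _ => Relation.ReflTransGen.trans) ha hb
  clear hb
  induction h with
  | refl => exact ⟨AnglePath.const a, .const a, rfl, rfl⟩
  | @tail c d _ hcd ih =>
    obtain ⟨e, he, h1, rfl⟩ := ih
    exact ⟨e.extend d, he.extend hcd, h1, rfl⟩

theorem exists_fine_isStepPath {F : Set ℂ} (hF : IsPreconnected F) {δ : ℝ} (hδ : 0 < δ)
    {a b : ℂ} (ha : a ∈ F) (hb : b ∈ F) :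
    ∃ e, IsStepPath (FineStep F δ) e ∧ e.src = a ∧ e.tgt = b := by
  refine exists_isStepPath_of_isPreconnected hF (fun x hx => ?_) ha hb
  filter_upwards [self_mem_nhdsWithin, mem_nhdsWithin_of_mem_nhds (Metric.ball_mem_nhds x hδ)]
    with y hy hyx
  exact ⟨⟨hx, hy, by rw [dist_comm]; exact hyx⟩, hy, hx, hyx⟩

theorem exists_away_isStepPath {F G : Set ℂ} (hG : IsClosed G) (hne : G.Nonempty)
    (hFG : IsPreconnected (F \ G)) {a b : ℂ} (ha : a ∈ F \ G) (hb : b ∈ F \ G) :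
    ∃ e, IsStepPath (AwayStep F G) e ∧ e.src = a ∧ e.tgt = b := by
  refine exists_isStepPath_of_isPreconnected hFG (fun x hx => ?_) ha hb
  have hd : 0 < Metric.infDist x G := (hG.notMem_iff_infDist_pos hne).1 hx.2
  filter_upwards [self_mem_nhdsWithin,
    mem_nhdsWithin_of_mem_nhds (Metric.ball_mem_nhds x (show 0 < Metric.infDist x G / 4 by linarith))]
    with y hy hyx
  rw [Metric.mem_ball] at hyx
  have := Metric.infDist_le_infDist_add_dist (s := G) (x := x) (y := y)
  rw [dist_comm] at this
  exact ⟨⟨hx, hy, by rw [dist_comm]; linarith⟩, hy, hx, by linarith⟩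

theorem eventually_crossing_eq_zero {F G : Set ℂ} (hG : IsClosed G) (hne : G.Nonempty)
    {t : AnglePath} (ht : IsStepPath (AwayStep F G) t) :
    ∀ᶠ δ in 𝓝[>] (0 : ℝ), ∀ v, IsStepPath (FineStep G δ) v → crossing t v = 0 := by
  induction ht with
  | const a =>
    refine Eventually.of_forall fun δ v hv => ?_
    simp [crossing, AnglePath.const]
  | @extend e x' _ hx ih =>
    have hd : 0 < Metric.infDist e.tgt G := (hG.notMem_iff_infDist_pos hne).1 hx.1.2
    filter_upwards [ih, mem_nhdsWithin_of_mem_nhds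
      (Iio_mem_nhds (show 0 < Metric.infDist e.tgt G / 2 by linarith))] with δ h1 h2 v hv
    have h3 := h1 v hv
    have h4 : crossing ((AnglePath.const e.tgt).extend x') v = 0 :=
      crossing_eq_zero_of_isStepPath (R := fun x y => x = e.tgt ∧ y = x')
        (.extend (.const _) ⟨rfl, rfl⟩) hv (by
          rintro _ _ y y' ⟨rfl, rfl⟩ ⟨hy, -, hyy⟩
          have := Metric.infDist_le_dist_of_mem (x := e.tgt) hy
          have := hx.2.2
          rw [mem_Iio] at h2
          linarith)
    simp only [crossing, AnglePath.extend, AnglePath.const] at *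
    linarith

/-- Crossing numbers of fine paths in `F` and `G` issuing from fixed sources are additive in
the targets when the targets lie in `F \ G` and `G \ F`. -/
theorem eventually_crossing_additive {F G : Set ℂ} (hF : IsClosed F) (hG : IsClosed G)
    (hFG : IsPreconnected (F \ G)) (hGF : IsPreconnected (G \ F))
    {x x' y y' : ℂ} (hx : x ∈ F \ G) (hx' : x' ∈ F \ G) (hy : y ∈ G \ F) (hy' : y' ∈ G \ F) :
    ∀ᶠ δ in 𝓝[>] (0 : ℝ), ∀ u u' v v' : AnglePath,
      IsStepPath (FineStep F δ) u → IsStepPath (FineStep F δ) u' →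
      IsStepPath (FineStep G δ) v → IsStepPath (FineStep G δ) v' →
      u.src = u'.src → v.src = v'.src → u.tgt = x → u'.tgt = x' → v.tgt = y → v'.tgt = y' →
      crossing u v + crossing u' v' = crossing u v' + crossing u' v := by
  obtain ⟨t, ht, ht1, ht2⟩ := exists_away_isStepPath hG ⟨y, hy.1⟩ hFG hx hx'
  obtain ⟨s, hs, hs1, hs2⟩ := exists_away_isStepPath hF ⟨x, hx.1⟩ hGF hy hy'
  have hts : crossing t s = 0 := crossing_eq_zero_of_isStepPath ht hs (by
    rintro a a' b b' ⟨ha, -, haa⟩ ⟨hb, -, hbb⟩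
    have h1 := Metric.infDist_le_dist_of_mem (x := a) hb.1
    have h2 := Metric.infDist_le_dist_of_mem (x := b) ha.1
    rw [dist_comm] at h2
    linarith)
  filter_upwards [eventually_crossing_eq_zero hG ⟨y, hy.1⟩ ht,
    eventually_crossing_eq_zero hF ⟨x, hx.1⟩ hs] with δ h1 h2 u u' v v' hu hu' hv hv' e1 e2 e3 e4
      e5 e6
  have a1 := h1 v hv
  have a2 := h1 v' hv'
  have a3 := h2 u hu
  have a4 := h2 u' hu'
  simp only [crossing, e1, e2, e3, e4, e5, e6, ht1, ht2, hs1, hs2] at *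
  linarith

/-! ### The parity obstruction for `K₃,₃` -/

/-- The sum of `N i j k l` over the pairs of independent edges `ij`, `kl` of `K₃,₃`. -/
def independentSum (N : Fin 3 → Fin 3 → Fin 3 → Fin 3 → ℤ) : ℤ :=
  (N 0 0 1 1 + N 0 1 1 0 + N 0 0 1 2 + N 0 2 1 0 + N 0 1 1 2 + N 0 2 1 1) +
  (N 0 0 2 1 + N 0 1 2 0 + N 0 0 2 2 + N 0 2 2 0 + N 0 1 2 2 + N 0 2 2 1) +
  (N 1 0 2 1 + N 1 1 2 0 + N 1 0 2 2 + N 1 2 2 0 + N 1 1 2 2 + N 1 2 2 1)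

theorem AnglePath.exists_crossing_eq {e f : AnglePath} (h1 : e.src ≠ f.src)
    (h2 : e.src ≠ f.tgt) (h3 : e.tgt ≠ f.src) (h4 : e.tgt ≠ f.tgt) :
    ∃ n : ℤ, crossing e f = 2 * Real.pi * n := by
  obtain ⟨n1, e1⟩ := e.exists_turn_eq f.src
  obtain ⟨n2, e2⟩ := e.exists_turn_eq f.tgt
  obtain ⟨n3, e3⟩ := f.exists_turn_eq e.tgt
  obtain ⟨n4, e4⟩ := f.exists_turn_eq e.src
  obtain ⟨m1, g1⟩ := exists_arg_sub_swap h1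
  obtain ⟨m2, g2⟩ := exists_arg_sub_swap h2
  obtain ⟨m3, g3⟩ := exists_arg_sub_swap h3
  obtain ⟨m4, g4⟩ := exists_arg_sub_swap h4
  refine ⟨n1 - n2 + n3 - n4 + m3 - m1 - m4 + m2, ?_⟩
  push_cast
  rw [crossing, e1, e2, e3, e4]
  linarith

theorem exists_odd_independentSum {p r : Fin 3 → ℂ} {e : Fin 3 → Fin 3 → AnglePath}
    (hsrc : ∀ i j, (e i j).src = p i) (htgt : ∀ i j, (e i j).tgt = r j)
    (hp : Function.Injective p) (hr : Function.Injective r) (hpr : ∀ i j, p i ≠ r j) :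
    ∃ N : Fin 3 → Fin 3 → Fin 3 → Fin 3 → ℤ,
      (∀ i j k l, i ≠ k → j ≠ l → crossing (e i j) (e k l) = 2 * Real.pi * N i j k l) ∧
      Odd (independentSum N) := by
  choose nA hA using fun i j k => (e i j).exists_turn_eq (p k)
  choose nB hB using fun i j l => (e i j).exists_turn_eq (r l)
  simp only [hsrc, htgt] at hA hB
  have swapP : ∀ i k, ∃ n : ℤ, i ≠ k → Complex.arg (p i - p k) - Complex.arg (p k - p i) =
      Real.pi + 2 * Real.pi * n := fun i k => by
    by_cases h : i = k
    · exact ⟨0, fun h' => absurd h h'⟩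
    · obtain ⟨n, hn⟩ := exists_arg_sub_swap (hp.ne h)
      exact ⟨n, fun _ => hn⟩
  have swapR : ∀ j l, ∃ n : ℤ, j ≠ l → Complex.arg (r j - r l) - Complex.arg (r l - r j) =
      Real.pi + 2 * Real.pi * n := fun i k => by
    by_cases h : i = k
    · exact ⟨0, fun h' => absurd h h'⟩
    · obtain ⟨n, hn⟩ := exists_arg_sub_swap (hr.ne h)
      exact ⟨n, fun _ => hn⟩
  choose mP hP using swapP
  choose mR hR using swapR
  choose mM hM using fun j k => exists_arg_sub_swap (hpr k j).symm
  have mR' : ∀ j l, j ≠ l → mR l j = -1 - mR j l := fun j l h => by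
    have h1 := hR j l h
    have h2 := hR l j h.symm
    have h3 : (2 * Real.pi) * ((mR l j : ℝ) + 1 + mR j l) = 0 := by linarith
    have h4 := (mul_eq_zero.1 h3).resolve_left (by positivity)
    have h5 : mR l j + 1 + mR j l = 0 := by exact_mod_cast h4
    omega
  refine ⟨fun i j k l => nA i j k - nB i j l + nB k l j - nA k l i + mM j k - mM l i
    - mP i k - mR j l - 1, fun i j k l hik hjl => ?_, ?_⟩
  · have h1 := hP i k hik
    have h2 := hR j l hjl
    have h3 := hM j k
    have h4 := hM l i
    rw [crossing, hsrc, htgt, hsrc, htgt, hA, hB, hA, hB]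
    push_cast
    linarith
  · have h1 := mR' 0 1 (by decide)
    have h2 := mR' 0 2 (by decide)
    have h3 := mR' 1 2 (by decide)
    rw [Int.odd_iff]
    simp only [independentSum]
    omega

/-- A non-piercing realisation by closed connected sets of `K₃,₃` as an intersection pattern,
in which every edge is witnessed by a point lying in no other set, is impossible in the plane. -/
theorem false_of_isolated_bipartite {A B : Fin 3 → Set ℂ} {q : Fin 3 → Fin 3 → ℂ}
    (cA : ∀ i, IsClosed (A i)) (cB : ∀ j, IsClosed (B j))
    (pA : ∀ i, IsPreconnected (A i)) (pB : ∀ j, IsPreconnected (B j))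
    (dAA : ∀ i k, i ≠ k → IsPreconnected (A i \ A k))
    (dBB : ∀ j l, j ≠ l → IsPreconnected (B j \ B l))
    (dAB : ∀ i j, IsPreconnected (A i \ B j)) (dBA : ∀ i j, IsPreconnected (B j \ A i))
    (qA : ∀ i j k, q i j ∈ A k ↔ i = k) (qB : ∀ i j l, q i j ∈ B l ↔ j = l) : False := by
  have qne : ∀ i j k l, (i ≠ k ∨ j ≠ l) → q i j ≠ q k l := by
    rintro i j k l (h | h) heq
    · exact h ((qA i j k).1 (heq ▸ (qA k l k).2 rfl))
    · exact h ((qB i j l).1 (heq ▸ (qB k l l).2 rfl))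
  have evAA : ∀ᶠ δ in 𝓝[>] (0 : ℝ), ∀ i k j j' l l', i ≠ k → ∀ u u' v v' : AnglePath,
      IsStepPath (FineStep (A i) δ) u → IsStepPath (FineStep (A i) δ) u' →
      IsStepPath (FineStep (A k) δ) v → IsStepPath (FineStep (A k) δ) v' →
      u.src = u'.src → v.src = v'.src → u.tgt = q i j → u'.tgt = q i j' → v.tgt = q k l →
      v'.tgt = q k l' → crossing u v + crossing u' v' = crossing u v' + crossing u' v := by
    simp only [eventually_all]
    intro i k j j' l l' h
    exact eventually_crossing_additive (cA i) (cA k) (dAA i k h) (dAA k i h.symm)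
      (by simp [qA, h]) (by simp [qA, h]) (by simp [qA, h.symm]) (by simp [qA, h.symm])
  have evBB : ∀ᶠ δ in 𝓝[>] (0 : ℝ), ∀ j l i i' k k', j ≠ l → ∀ u u' v v' : AnglePath,
      IsStepPath (FineStep (B j) δ) u → IsStepPath (FineStep (B j) δ) u' →
      IsStepPath (FineStep (B l) δ) v → IsStepPath (FineStep (B l) δ) v' →
      u.src = u'.src → v.src = v'.src → u.tgt = q i j → u'.tgt = q i' j → v.tgt = q k l →
      v'.tgt = q k' l → crossing u v + crossing u' v' = crossing u v' + crossing u' v := by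
    simp only [eventually_all]
    intro i k j j' l l' h
    exact eventually_crossing_additive (cB i) (cB k) (dBB i k h) (dBB k i h.symm)
      (by simp [qB, h]) (by simp [qB, h]) (by simp [qB, h.symm]) (by simp [qB, h.symm])
  have evAB : ∀ᶠ δ in 𝓝[>] (0 : ℝ), ∀ i l j j' k k', j ≠ l → j' ≠ l → k ≠ i → k' ≠ i →
      ∀ u u' v v' : AnglePath,
      IsStepPath (FineStep (A i) δ) u → IsStepPath (FineStep (A i) δ) u' →
      IsStepPath (FineStep (B l) δ) v → IsStepPath (FineStep (B l) δ) v' →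
      u.src = u'.src → v.src = v'.src → u.tgt = q i j → u'.tgt = q i j' → v.tgt = q k l →
      v'.tgt = q k' l → crossing u v + crossing u' v' = crossing u v' + crossing u' v := by
    simp only [eventually_all]
    intro i l j j' k k' h1 h2 h3 h4
    exact eventually_crossing_additive (cA i) (cB l) (dAB i l) (dBA i l)
      (by simp [qA, qB, h1]) (by simp [qA, qB, h2]) (by simp [qA, qB, h3])
      (by simp [qA, qB, h4])
  obtain ⟨δ, ⟨⟨hAA, hBB⟩, hAB⟩, hδ : 0 < δ⟩ :=
    (((evAA.and evBB).and evAB).and self_mem_nhdsWithin).exists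
  choose ua ha ha1 ha2 using fun i j => exists_fine_isStepPath (pA i) hδ
    ((qA i i i).2 rfl) ((qA i j i).2 rfl)
  choose ub hb hb1 hb2 using fun j i => exists_fine_isStepPath (pB j) hδ
    ((qB (j + 1) j j).2 rfl) ((qB i j j).2 rfl)
  have hj : ∀ i j, (ua i j).tgt = (ub j i).tgt := fun i j => by rw [ha2, hb2]
  have succ_ne : ∀ j : Fin 3, j + 1 ≠ j := by decide
  obtain ⟨N, hN, hodd⟩ := exists_odd_independentSum (p := fun i => q i i)
    (r := fun j => q (j + 1) j) (e := fun i j => AnglePath.join (ua i j) (ub j i) (hj i j))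
    (fun i j => ha1 i j) (fun i j => hb1 j i)
    (fun i k h => by by_contra h'; exact qne i i k k (Or.inl h') h)
    (fun i k h => by by_contra h'; exact qne _ _ _ _ (Or.inr h') h)
    (fun i j => qne _ _ _ _ (by
      by_cases h : i = j
      · subst h; exact Or.inl (succ_ne i).symm
      · exact Or.inr h))
  have intAA : ∀ i j k l, ∃ n : ℤ, i ≠ k → crossing (ua i j) (ua k l) = 2 * Real.pi * n := by
    intro i j k l
    by_cases h : i = k
    · exact ⟨0, fun h' => absurd h h'⟩
    · obtain ⟨n, hn⟩ := exists_crossing_eq (e := ua i j) (f := ua k l)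
        (by rw [ha1, ha1]; exact qne _ _ _ _ (Or.inl h))
        (by rw [ha1, ha2]; exact qne _ _ _ _ (Or.inl h))
        (by rw [ha2, ha1]; exact qne _ _ _ _ (Or.inl h))
        (by rw [ha2, ha2]; exact qne _ _ _ _ (Or.inl h))
      exact ⟨n, fun _ => hn⟩
  have intBB : ∀ j i l k, ∃ n : ℤ, j ≠ l → crossing (ub j i) (ub l k) = 2 * Real.pi * n := by
    intro j i l k
    by_cases h : j = l
    · exact ⟨0, fun h' => absurd h h'⟩
    · obtain ⟨n, hn⟩ := exists_crossing_eq (e := ub j i) (f := ub l k)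
        (by rw [hb1, hb1]; exact qne _ _ _ _ (Or.inr h))
        (by rw [hb1, hb2]; exact qne _ _ _ _ (Or.inr h))
        (by rw [hb2, hb1]; exact qne _ _ _ _ (Or.inr h))
        (by rw [hb2, hb2]; exact qne _ _ _ _ (Or.inr h))
      exact ⟨n, fun _ => hn⟩
  have intAB : ∀ i j l k, ∃ n : ℤ, i ≠ k → j ≠ l →
      crossing (ua i j) (ub l k) = 2 * Real.pi * n := by
    intro i j l k
    by_cases h : i = k ∨ j = l
    · exact ⟨0, fun h1 h2 => absurd h (by tauto)⟩
    · push Not at h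
      obtain ⟨n, hn⟩ := exists_crossing_eq (e := ua i j) (f := ub l k)
        (by
          rw [ha1, hb1]
          refine qne _ _ _ _ ?_
          by_cases h : i = l
          · subst h; exact Or.inl (succ_ne i).symm
          · exact Or.inr h)
        (by rw [ha1, hb2]; exact qne _ _ _ _ (Or.inl h.1))
        (by rw [ha2, hb1]; exact qne _ _ _ _ (Or.inr h.2))
        (by rw [ha2, hb2]; exact qne _ _ _ _ (Or.inr h.2))
      exact ⟨n, fun _ _ => hn⟩
  choose P hP using intAA
  choose Q hQ using intBB
  choose M hM using intAB
  have two_pi_inj : ∀ {m n : ℤ}, 2 * Real.pi * (m : ℝ) = 2 * Real.pi * n → m = n :=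
    fun {m n} h => by exact_mod_cast mul_left_cancel₀ (by positivity) h
  have addP : ∀ i k j j' l l', i ≠ k → P i j k l + P i j' k l' = P i j k l' + P i j' k l := by
    intro i k j j' l l' h
    have := hAA i k j j' l l' h _ _ _ _ (ha i j) (ha i j') (ha k l) (ha k l')
      (by simp [ha1]) (by simp [ha1]) (ha2 _ _) (ha2 _ _) (ha2 _ _) (ha2 _ _)
    rw [hP _ _ _ _ h, hP _ _ _ _ h, hP _ _ _ _ h, hP _ _ _ _ h] at this
    exact two_pi_inj (by push_cast; linarith)
  have addQ : ∀ j l i i' k k', j ≠ l → Q j i l k + Q j i' l k' = Q j i l k' + Q j i' l k := by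
    intro i k j j' l l' h
    have := hBB i k j j' l l' h _ _ _ _ (hb i j) (hb i j') (hb k l) (hb k l')
      (by simp [hb1]) (by simp [hb1]) (hb2 _ _) (hb2 _ _) (hb2 _ _) (hb2 _ _)
    rw [hQ _ _ _ _ h, hQ _ _ _ _ h, hQ _ _ _ _ h, hQ _ _ _ _ h] at this
    exact two_pi_inj (by push_cast; linarith)
  have addM : ∀ i l j j' k k', j ≠ l → j' ≠ l → k ≠ i → k' ≠ i →
      M i j l k + M i j' l k' = M i j l k' + M i j' l k := by
    intro i l j j' k k' h1 h2 h3 h4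
    have := hAB i l j j' k k' h1 h2 h3 h4 _ _ _ _ (ha i j) (ha i j') (hb l k) (hb l k')
      (by simp [ha1]) (by simp [hb1]) (ha2 _ _) (ha2 _ _) (hb2 _ _) (hb2 _ _)
    rw [hM _ _ _ _ h3.symm h1, hM _ _ _ _ h3.symm h2, hM _ _ _ _ h4.symm h1,
      hM _ _ _ _ h4.symm h2] at this
    exact two_pi_inj (by push_cast; linarith)
  have hsplit : ∀ i j k l, i ≠ k → j ≠ l →
      N i j k l = P i j k l - M i j l k + M k l j i + Q j i l k := by
    intro i j k l h1 h2
    have e0 := hN i j k l h1 h2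
    have e1 := hP i j k l h1
    have e2 := hM i j l k h1 h2
    have e3 := hM k l j i h1.symm h2.symm
    have e4 := hQ j i l k h2
    refine two_pi_inj ?_
    rw [← e0]
    push_cast
    have : crossing (AnglePath.join (ua i j) (ub j i) (hj i j)) (AnglePath.join (ua k l) (ub l k) (hj k l)) =
        crossing (ua i j) (ua k l) - crossing (ua i j) (ub l k) + crossing (ua k l) (ub j i)
        + crossing (ub j i) (ub l k) := by
      simp only [crossing, AnglePath.join, ha1, ha2, hb1, hb2]; ring
    rw [this, e1, e2, e3, e4]; ring
  have antiQ : ∀ j i l k, j ≠ l → Q l k j i = - Q j i l k := by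
    intro j i l k h
    have h1 := hQ j i l k h
    have h2 := hQ l k j i h.symm
    refine two_pi_inj ?_
    rw [← h2]; push_cast
    have : crossing (ub l k) (ub j i) = - crossing (ub j i) (ub l k) := by
      simp only [crossing]; ring
    rw [this, h1]; ring
  have evenP : ∀ i k, i ≠ k → (P i 0 k 1 + P i 1 k 0 + P i 0 k 2 + P i 2 k 0 + P i 1 k 2
      + P i 2 k 1) % 2 = 0 := by
    intro i k h
    have h1 := addP i k 0 1 0 1 h
    have h2 := addP i k 0 2 0 2 h
    have h3 := addP i k 1 2 1 2 h
    omega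
  have evenQ : ∀ j l, j ≠ l → (Q j 0 l 1 + Q j 0 l 2 + Q j 1 l 2 + Q l 0 j 1 + Q l 0 j 2
      + Q l 1 j 2) % 2 = 0 := by
    intro j l h
    have h1 := addQ j l 0 1 0 1 h
    have h2 := addQ j l 0 2 0 2 h
    have h3 := addQ j l 1 2 1 2 h
    have h4 := antiQ j 1 l 0 h
    have h5 := antiQ j 2 l 0 h
    have h6 := antiQ j 2 l 1 h
    omega
  have evenM : ∀ i i1 i2 l l1 l2, i1 ≠ i → i2 ≠ i → l1 ≠ l → l2 ≠ l →
      (M i l1 l i1 + M i l2 l i2 + M i l1 l i2 + M i l2 l i1) % 2 = 0 := by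
    intro i i1 i2 l l1 l2 h1 h2 h3 h4
    have := addM i l l1 l2 i1 i2 h3 h4 h1 h2
    omega
  rw [Int.odd_iff, independentSum] at hodd
  simp (discharger := decide) only [hsplit] at hodd
  have a1 := evenP 0 1 (by decide)
  have a2 := evenP 0 2 (by decide)
  have a3 := evenP 1 2 (by decide)
  have b1 := evenQ 0 1 (by decide)
  have b2 := evenQ 0 2 (by decide)
  have b3 := evenQ 1 2 (by decide)
  have c00 := evenM 0 1 2 0 1 2 (by decide) (by decide) (by decide) (by decide)
  have c01 := evenM 0 1 2 1 0 2 (by decide) (by decide) (by decide) (by decide)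
  have c02 := evenM 0 1 2 2 0 1 (by decide) (by decide) (by decide) (by decide)
  have c10 := evenM 1 0 2 0 1 2 (by decide) (by decide) (by decide) (by decide)
  have c11 := evenM 1 0 2 1 0 2 (by decide) (by decide) (by decide) (by decide)
  have c12 := evenM 1 0 2 2 0 1 (by decide) (by decide) (by decide) (by decide)
  have c20 := evenM 2 0 1 0 1 2 (by decide) (by decide) (by decide) (by decide)
  have c21 := evenM 2 0 1 1 0 2 (by decide) (by decide) (by decide) (by decide)
  have c22 := evenM 2 0 1 2 0 1 (by decide) (by decide) (by decide) (by decide)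
  clear * - hodd a1 a2 a3 b1 b2 b3 c00 c01 c02 c10 c11 c12 c20 c21 c22
  omega

/-! ### Fractional matchings -/

/-- No six members of the set system form an isolated `K₃,₃`: for any two triples, it is impossible
to choose for each cross pair a point lying in these two members and in none of the other four. -/
def NoIsolatedBipartite {α ι : Type*} (S : ι → Set α) : Prop :=
  ∀ (a b : Fin 3 → ι) (q : Fin 3 → Fin 3 → α), (∀ i j k, q i j ∈ S (a k) ↔ i = k) →
    (∀ i j l, q i j ∈ S (b l) ↔ j = l) → False

open Classical in
theorem exists_independent_card_ge {ι : Type*} [Fintype ι] {w : ι → ℝ} (hw : ∀ x, 0 ≤ w x)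
    {R : ι → ι → Prop} (hR : ∀ x, R x x) (hsymm : ∀ x y, R x y → R y x) (s : Finset ι) :
    ∃ t ⊆ s, (∀ x ∈ t, ∀ y ∈ t, x ≠ y → ¬ R x y) ∧
      ∑ x ∈ s, w x / (∑ y, if R x y then w y else 0) ≤ (t.card : ℝ) := by
  set d : ι → ℝ := fun x => ∑ y, if R x y then w y else 0 with hd
  have hd0 : ∀ x, 0 ≤ d x := fun x => Finset.sum_nonneg fun y _ => by split_ifs <;> simp [hw]
  induction s using Finset.strongInduction with
  | H s ih =>
    rcases s.eq_empty_or_nonempty with rfl | hs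
    · exact ⟨∅, by simp⟩
    obtain ⟨x, hx, hmin⟩ := s.exists_min_image d hs
    obtain ⟨t, hts, hind, hsum⟩ := ih (s.filter fun y => ¬ R x y)
      (Finset.filter_ssubset.2 ⟨x, hx, by simpa using hR x⟩)
    have hxt : ∀ y ∈ t, ¬ R x y := fun y hy => (Finset.mem_filter.1 (hts hy)).2
    have hnot : x ∉ t := fun h => hxt x h (hR x)
    refine ⟨insert x t, ?_, ?_, ?_⟩
    · intro y hy
      rcases Finset.mem_insert.1 hy with rfl | hy
      · exact hx
      · exact (Finset.mem_filter.1 (hts hy)).1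
    · intro y hy z hz hne
      rcases Finset.mem_insert.1 hy with rfl | hy' <;>
        rcases Finset.mem_insert.1 hz with rfl | hz'
      · exact absurd rfl hne
      · exact hxt z hz'
      · exact fun h => hxt y hy' (hsymm _ _ h)
      · exact hind y hy' z hz' hne
    · rw [Finset.card_insert_of_notMem hnot, ← Finset.sum_filter_add_sum_filter_not s (R x)]
      have hle : ∑ y ∈ s.filter (R x), w y / d y ≤ ∑ y ∈ s.filter (R x), w y / d x := by
        refine Finset.sum_le_sum fun y hy => ?_
        have hy' := Finset.mem_filter.1 hy
        rcases (hd0 x).eq_or_lt with h0 | h0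
        · have : w y = 0 := by
            have h1 := (Finset.sum_eq_zero_iff_of_nonneg (fun y _ => by
              split_ifs <;> simp [hw])).1 h0.symm y (Finset.mem_univ y)
            simpa [hy'.2] using h1
          simp [this]
        · exact div_le_div_of_nonneg_left (hw y) h0 (hmin y hy'.1)
      have hone : ∑ y ∈ s.filter (R x), w y / d x ≤ 1 := by
        rw [← Finset.sum_div]
        refine div_le_one_of_le₀ ?_ (hd0 x)
        rw [hd]
        simp only
        rw [← Finset.sum_filter]
        exact Finset.sum_le_sum_of_subset_of_nonneg
          (Finset.filter_subset_filter _ (Finset.subset_univ _)) fun y _ _ => hw y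
      push_cast
      linarith

open Classical in
/-- A weighted form of Turán's theorem. -/
theorem one_le_mul_sum_related {ι : Type*} [Fintype ι] {w : ι → ℝ} (hw : ∀ x, 0 ≤ w x)
    (hw1 : ∑ x, w x = 1) {R : ι → ι → Prop} (hR : ∀ x, R x x) (hsymm : ∀ x y, R x y → R y x)
    {n : ℕ} (hn : ∀ t : Finset ι, (∀ x ∈ t, ∀ y ∈ t, x ≠ y → ¬ R x y) → t.card ≤ n) :
    1 ≤ (n : ℝ) * ∑ x, w x * ∑ y, w y * (if R x y then 1 else 0) := by
  obtain ⟨t, -, ht, hsum⟩ := exists_independent_card_ge hw hR hsymm Finset.univ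
  have hcard : (t.card : ℝ) ≤ n := by exact_mod_cast hn t ht
  have hd : ∀ x, ∑ y, w y * (if R x y then (1 : ℝ) else 0) = ∑ y, if R x y then w y else 0 :=
    fun x => Finset.sum_congr rfl fun y _ => by split_ifs <;> simp
  simp only [hd]
  set d : ι → ℝ := fun x => ∑ y, if R x y then w y else 0
  have hwd : ∀ x, w x ≤ d x := fun x => by
    have := Finset.single_le_sum (f := fun y => if R x y then w y else 0)
      (fun y _ => by split_ifs <;> simp [hw]) (Finset.mem_univ x)
    simpa [hR x] using this
  have hd0 : ∀ x, 0 ≤ d x := fun x => (hw x).trans (hwd x)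
  have hcs := Finset.sum_sq_le_sum_mul_sum_of_sq_le_mul Finset.univ (r := w)
    (f := fun x => w x / d x) (g := fun x => w x * d x)
    (fun x _ => div_nonneg (hw x) (hd0 x)) (fun x _ => mul_nonneg (hw x) (hd0 x))
    (fun x _ => by
      rcases (hd0 x).eq_or_lt with h0 | h0
      · have : w x = 0 := le_antisymm (h0 ▸ hwd x) (hw x)
        simp [this]
      · have := h0.ne'
        exact le_of_eq (by field_simp))
  rw [hw1] at hcs
  have hnn : 0 ≤ ∑ x, w x * d x := Finset.sum_nonneg fun x _ => mul_nonneg (hw x) (hd0 x)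
  calc (1 : ℝ) = 1 ^ 2 := by norm_num
    _ ≤ _ := hcs
    _ ≤ _ := mul_le_mul_of_nonneg_right (hsum.trans hcard) hnn

/-- The homomorphism density of `K₃,₃` is at least the ninth power of the edge density. -/
theorem edge_density_pow_nine_le {ι : Type*} [Fintype ι] {w : ι → ℝ} (hw : ∀ x, 0 ≤ w x)
    (hw1 : ∑ x, w x = 1) {M : ι → ι → ℝ} (hM : ∀ x y, 0 ≤ M x y) :
    (∑ x, w x * ∑ y, w y * M x y) ^ 9 ≤
      ∑ a : Fin 3 → ι, ∑ b : Fin 3 → ι,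
        (∏ i, w (a i)) * (∏ j, w (b j)) * ∏ i, ∏ j, M (a i) (b j) := by
  have hnn : ∀ x, 0 ≤ ∑ y, w y * M x y := fun x =>
    Finset.sum_nonneg fun y _ => mul_nonneg (hw y) (hM x y)
  have hprod : ∀ a : Fin 3 → ι, ∑ b : Fin 3 → ι, (∏ j, w (b j)) * ∏ i, ∏ j, M (a i) (b j) =
      (∑ y, w y * ∏ i, M (a i) y) ^ 3 := fun a => by
    rw [Fintype.sum_pow]
    refine Finset.sum_congr rfl fun b _ => ?_
    rw [Finset.prod_comm (s := Finset.univ), ← Finset.prod_mul_distrib]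
  have hswap : ∑ a : Fin 3 → ι, (∏ i, w (a i)) * ∑ y, w y * ∏ i, M (a i) y =
      ∑ y, w y * (∑ x, w x * M x y) ^ 3 := by
    simp only [Finset.mul_sum]
    rw [Finset.sum_comm]
    refine Finset.sum_congr rfl fun y _ => ?_
    rw [Fintype.sum_pow, Finset.mul_sum]
    refine Finset.sum_congr rfl fun a _ => ?_
    rw [Finset.prod_mul_distrib]; ring
  have hcomm : ∑ y, w y * ∑ x, w x * M x y = ∑ x, w x * ∑ y, w y * M x y := by
    simp only [Finset.mul_sum]
    rw [Finset.sum_comm]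
    exact Finset.sum_congr rfl fun x _ => Finset.sum_congr rfl fun y _ => by ring
  have hw3 : ∑ a : Fin 3 → ι, ∏ i, w (a i) = 1 := by rw [← Fintype.sum_pow, hw1, one_pow]
  have h1 := Real.pow_arith_mean_le_arith_mean_pow Finset.univ w (fun y => ∑ x, w x * M x y)
    (fun x _ => hw x) hw1
    (fun y _ => Finset.sum_nonneg fun x _ => mul_nonneg (hw x) (hM x y)) 3
  have h2 := Real.pow_arith_mean_le_arith_mean_pow Finset.univ
    (fun a : Fin 3 → ι => ∏ i, w (a i)) (fun a => ∑ y, w y * ∏ i, M (a i) y)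
    (fun a _ => Finset.prod_nonneg fun i _ => hw _) hw3
    (fun a _ => Finset.sum_nonneg fun y _ => mul_nonneg (hw y)
      (Finset.prod_nonneg fun i _ => hM _ _)) 3
  rw [hcomm] at h1
  rw [hswap] at h2
  calc _ = ((∑ x, w x * ∑ y, w y * M x y) ^ 3) ^ 3 := by rw [← pow_mul]
    _ ≤ _ := pow_le_pow_left₀ (pow_nonneg (Finset.sum_nonneg fun x _ =>
        mul_nonneg (hw x) (hnn x)) 3) h1 3
    _ ≤ _ := h2
    _ = _ := by
      refine Finset.sum_congr rfl fun a _ => ?_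
      rw [← hprod, Finset.mul_sum]
      exact Finset.sum_congr rfl fun b _ => by ring

open Classical in
/-- If, given the other coordinates, each coordinate avoids a condition with high probability,
then so does a random triple. -/
theorem sum_prod_ite_le {ι : Type*} [Fintype ι] {w : ι → ℝ} (hw : ∀ x, 0 ≤ w x)
    (hw1 : ∑ x, w x = 1) {β : ℝ} {i k : Fin 3} (hik : i ≠ k) {T : ι → ι → Prop}
    (hT : ∀ x, ∑ y, w y * (if T x y then 1 else 0) ≤ β) :
    ∑ a : Fin 3 → ι, (∏ i, w (a i)) * (if T (a i) (a k) then 1 else 0) ≤ β := by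
  obtain ⟨i', rfl⟩ := Fin.exists_succAbove_eq hik
  rw [← (Fin.insertNthEquiv (fun _ => ι) k).sum_comp, Fintype.sum_prod_type_right]
  have h : ∀ (c : Fin 2 → ι), ∑ y, (∏ i, w (Fin.insertNthEquiv (fun _ => ι) k (y, c) i)) *
      (if T (Fin.insertNthEquiv (fun _ => ι) k (y, c) (k.succAbove i'))
        (Fin.insertNthEquiv (fun _ => ι) k (y, c) k) then 1 else 0) ≤ (∏ i, w (c i)) * β := by
    intro c
    simp only [Fin.prod_univ_succAbove _ k, Fin.insertNthEquiv_apply, Fin.insertNth_apply_same,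
      Fin.insertNth_apply_succAbove]
    have := mul_le_mul_of_nonneg_left (hT (c i'))
      (Finset.prod_nonneg fun i (_ : i ∈ Finset.univ) => hw (c i))
    rw [Finset.mul_sum] at this
    exact (Finset.sum_congr rfl fun y _ => by ring).trans_le this
  refine (Finset.sum_le_sum fun c _ => h c).trans ?_
  rw [← Finset.sum_mul, ← Fintype.sum_pow, hw1, one_pow, one_mul]

open Classical in
/-- In a fractional matching of total weight one, some point has depth at least `1 / (36 ν⁹)`. -/
theorem one_le_mul_matching_pow_nine {α ι : Type*} [Fintype ι] {S : ι → Set α}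
    (hK : NoIsolatedBipartite S) (hne : ∀ x, (S x).Nonempty) {w : ι → ℝ} (hw : ∀ x, 0 ≤ w x)
    (hw1 : ∑ x, w x = 1) {β : ℝ} (hβ : ∀ p, ∑ x, w x * (if p ∈ S x then 1 else 0) ≤ β)
    {n : ℕ} (hn : ∀ t : Finset ι, (∀ x ∈ t, ∀ y ∈ t, x ≠ y → Disjoint (S x) (S y)) →
      t.card ≤ n) :
    1 ≤ 36 * β * (n : ℝ) ^ 9 := by
  set M : ι → ι → ℝ := fun x y => if (S x ∩ S y).Nonempty then 1 else 0 with hMdef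
  have hM : ∀ x y, 0 ≤ M x y := fun x y => by simp only [hMdef]; split_ifs <;> simp
  have hturan := one_le_mul_sum_related hw hw1 (R := fun x y => (S x ∩ S y).Nonempty)
    (fun x => by simpa using hne x) (fun x y h => by rwa [inter_comm]) (n := n)
    (fun t ht => hn t fun x hx y hy hxy =>
      disjoint_iff_inter_eq_empty.2 (not_nonempty_iff_eq_empty.1 (ht x hx y hy hxy)))
  have hdens := edge_density_pow_nine_le hw hw1 hM
  set A := ∑ x, w x * ∑ y, w y * M x y with hA
  have hα : ∃ q : ι → ι → α, ∀ x y, (S x ∩ S y).Nonempty → q x y ∈ S x ∩ S y := by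
    have : ∀ x y, ∃ p, (S x ∩ S y).Nonempty → p ∈ S x ∩ S y := fun x y => by
      by_cases h : (S x ∩ S y).Nonempty
      · exact ⟨h.some, fun _ => h.some_mem⟩
      · exact ⟨(hne x).some, fun h' => absurd h' h⟩
    choose q hq using this
    exact ⟨q, hq⟩
  obtain ⟨q, hq⟩ := hα
  set D : Fin 3 → Fin 3 → ℝ := fun i k => if i = k then 0 else 1 with hD
  set E : ι → ι → ι → ℝ := fun x y z => if q x y ∈ S z then 1 else 0 with hE
  have hE0 : ∀ x y z, 0 ≤ E x y z := fun x y z => by simp only [hE]; split_ifs <;> simp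
  have hD0 : ∀ i k, 0 ≤ D i k := fun i k => by simp only [hD]; split_ifs <;> simp
  have hbad0 : ∀ (a b : Fin 3 → ι) i j k, 0 ≤ D i k * E (a i) (b j) (a k)
      + D j k * E (a i) (b j) (b k) := fun a b i j k =>
    add_nonneg (mul_nonneg (hD0 _ _) (hE0 _ _ _)) (mul_nonneg (hD0 _ _) (hE0 _ _ _))
  have hpoint : ∀ a b : Fin 3 → ι, ∏ i, ∏ j, M (a i) (b j) ≤
      ∑ i, ∑ j, ∑ k, (D i k * E (a i) (b j) (a k) + D j k * E (a i) (b j) (b k)) := by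
    intro a b
    by_cases hall : ∀ i j, (S (a i) ∩ S (b j)).Nonempty
    swap
    · push Not at hall
      obtain ⟨i, j, hij⟩ := hall
      have : ∏ i, ∏ j, M (a i) (b j) = 0 :=
        Finset.prod_eq_zero (Finset.mem_univ i) (Finset.prod_eq_zero (Finset.mem_univ j)
          (by simp [hMdef, hij]))
      rw [this]
      exact Finset.sum_nonneg fun i _ => Finset.sum_nonneg fun j _ => Finset.sum_nonneg fun k _ =>
        hbad0 a b i j k
    have hone : ∏ i, ∏ j, M (a i) (b j) = 1 :=
      Finset.prod_eq_one fun i _ => Finset.prod_eq_one fun j _ => by simp [hMdef, hall i j]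
    rw [hone]
    have hex : ∃ i j k, 1 ≤ D i k * E (a i) (b j) (a k) + D j k * E (a i) (b j) (b k) := by
      by_contra hcon
      push Not at hcon
      refine hK a b (fun i j => q (a i) (b j)) (fun i j k => ⟨fun h => ?_, ?_⟩)
        (fun i j k => ⟨fun h => ?_, ?_⟩)
      · by_contra hik
        have h1 := hcon i j k
        have h2 := mul_nonneg (hD0 j k) (hE0 (a i) (b j) (b k))
        have h3 : D i k * E (a i) (b j) (a k) = 1 := by simp [hD, hE, hik, h]
        linarith
      · rintro rfl; exact (hq _ _ (hall i j)).1
      · by_contra hjk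
        have h1 := hcon i j k
        have h2 := mul_nonneg (hD0 i k) (hE0 (a i) (b j) (a k))
        have h3 : D j k * E (a i) (b j) (b k) = 1 := by simp [hD, hE, hjk, h]
        linarith
      · rintro rfl; exact (hq _ _ (hall i j)).2
    obtain ⟨i, j, k, hijk⟩ := hex
    refine hijk.trans ?_
    refine le_trans ?_ (Finset.single_le_sum (fun i _ => Finset.sum_nonneg fun j _ =>
      Finset.sum_nonneg fun k _ => hbad0 a b i j k) (Finset.mem_univ i))
    refine le_trans ?_ (Finset.single_le_sum (fun j _ =>
      Finset.sum_nonneg fun k _ => hbad0 a b i j k) (Finset.mem_univ j))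
    exact Finset.single_le_sum (fun k _ => hbad0 a b i j k) (Finset.mem_univ k)
  have hw3 : ∑ a : Fin 3 → ι, ∏ i, w (a i) = 1 := by rw [← Fintype.sum_pow, hw1, one_pow]
  have hwa : ∀ a : Fin 3 → ι, 0 ≤ ∏ i, w (a i) := fun a => Finset.prod_nonneg fun i _ => hw _
  have hterm1 : ∀ i j k, ∑ a : Fin 3 → ι, ∑ b : Fin 3 → ι, (∏ i, w (a i)) * (∏ j, w (b j)) *
      (D i k * E (a i) (b j) (a k)) ≤ D i k * β := by
    intro i j k
    by_cases hik : i = k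
    · simp [hD, hik]
    have hDik : D i k = 1 := by simp [hD, hik]
    rw [hDik, one_mul, Finset.sum_comm]
    calc _ ≤ ∑ b : Fin 3 → ι, (∏ j, w (b j)) * β := by
          refine Finset.sum_le_sum fun b _ => ?_
          have := mul_le_mul_of_nonneg_left (sum_prod_ite_le hw hw1 hik
            (T := fun x z => q x (b j) ∈ S z) (fun x => hβ _)) (hwa b)
          rw [Finset.mul_sum] at this
          exact (Finset.sum_congr rfl fun a _ => by simp only [hE]; ring).trans_le this
      _ = β := by rw [← Finset.sum_mul, hw3, one_mul]
  have hterm2 : ∀ i j k, ∑ a : Fin 3 → ι, ∑ b : Fin 3 → ι, (∏ i, w (a i)) * (∏ j, w (b j)) *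
      (D j k * E (a i) (b j) (b k)) ≤ D j k * β := by
    intro i j k
    by_cases hjk : j = k
    · simp [hD, hjk]
    have hDjk : D j k = 1 := by simp [hD, hjk]
    rw [hDjk, one_mul]
    calc _ ≤ ∑ a : Fin 3 → ι, (∏ j, w (a j)) * β := by
          refine Finset.sum_le_sum fun a _ => ?_
          have := mul_le_mul_of_nonneg_left (sum_prod_ite_le hw hw1 hjk
            (T := fun y z => q (a i) y ∈ S z) (fun x => hβ _)) (hwa a)
          rw [Finset.mul_sum] at this
          exact (Finset.sum_congr rfl fun a _ => by simp only [hE]; ring).trans_le this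
      _ = β := by rw [← Finset.sum_mul, hw3, one_mul]
  have hA9 : A ^ 9 ≤ 36 * β := by
    refine hdens.trans ?_
    calc _ ≤ ∑ a : Fin 3 → ι, ∑ b : Fin 3 → ι, (∏ i, w (a i)) * (∏ j, w (b j)) *
          ∑ i, ∑ j, ∑ k, (D i k * E (a i) (b j) (a k) + D j k * E (a i) (b j) (b k)) :=
          Finset.sum_le_sum fun a _ => Finset.sum_le_sum fun b _ =>
            mul_le_mul_of_nonneg_left (hpoint a b) (mul_nonneg (hwa a) (hwa b))
      _ = ∑ i, ∑ j, ∑ k, ((∑ a : Fin 3 → ι, ∑ b : Fin 3 → ι, (∏ i, w (a i)) * (∏ j, w (b j)) *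
            (D i k * E (a i) (b j) (a k))) + ∑ a : Fin 3 → ι, ∑ b : Fin 3 → ι,
            (∏ i, w (a i)) * (∏ j, w (b j)) * (D j k * E (a i) (b j) (b k))) := by
          simp only [Finset.mul_sum, mul_add, Finset.sum_add_distrib]
          simp only [Finset.sum_comm (s := (Finset.univ : Finset (Fin 3 → ι)))
            (t := (Finset.univ : Finset (Fin 3)))]
      _ ≤ ∑ i, ∑ j, ∑ k, (D i k * β + D j k * β) :=
          Finset.sum_le_sum fun i _ => Finset.sum_le_sum fun j _ => Finset.sum_le_sum fun k _ =>
            add_le_add (hterm1 i j k) (hterm2 i j k)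
      _ = 36 * β := by simp [hD, Fin.sum_univ_three]; ring
  have h9 : (1 : ℝ) ≤ (n * A) ^ 9 := one_le_pow₀ hturan
  rw [mul_pow] at h9
  have := mul_le_mul_of_nonneg_left hA9 (show (0 : ℝ) ≤ (n : ℝ) ^ 9 by positivity)
  linarith

/-! ### Linear programming duality -/

open Classical in
/-- If every weighting of the members of a finite set system has a point of depth at least `ε`,
then some finitely supported probability measure gives every member measure at least `ε`. -/
theorem exists_fractional_transversal {α ι : Type*} [Fintype ι] {S : ι → Set α} {ε : ℝ}
    (hε : 0 < ε) (hι : Nonempty ι)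
    (h : ∀ w : ι → ℝ, (∀ x, 0 ≤ w x) → ∑ x, w x = 1 →
      ∃ p, ε ≤ ∑ x, w x * (if p ∈ S x then 1 else 0)) :
    ∃ (n : ℕ) (pt : Fin n → α) (μ : Fin n → ℝ), (∀ k, 0 ≤ μ k) ∧ ∑ k, μ k = 1 ∧
      ∀ x, ε ≤ ∑ k, μ k * (if pt k ∈ S x then 1 else 0) := by
  have hpt : ∃ (n : ℕ) (pt : Fin n → α), ∀ p, ∃ k, ∀ x, pt k ∈ S x ↔ p ∈ S x := by
    let pat : α → ι → Prop := fun p x => p ∈ S x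
    have : Finite (Set.range pat) := inferInstance
    obtain ⟨n, ⟨e⟩⟩ := Finite.exists_equiv_fin (Set.range pat)
    refine ⟨n, fun k => (e.symm k).2.choose, fun p => ⟨e ⟨pat p, p, rfl⟩, fun x => ?_⟩⟩
    have h1 := (e.symm (e ⟨pat p, p, rfl⟩)).2.choose_spec
    have h2 := congrFun h1 x
    simp only [Equiv.symm_apply_apply] at h2
    rw [← eq_iff_iff]
    simpa [pat] using h2
  obtain ⟨n, pt, hpt⟩ := hpt
  set V : Fin n → ι → ℝ := fun k x => if pt k ∈ S x then 1 else 0 with hV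
  let L : (Fin n → ℝ) →ₗ[ℝ] (ι → ℝ) := ∑ k, (LinearMap.proj k).smulRight (V k)
  have hL : ∀ μ x, L μ x = ∑ k, μ k * V k x := fun μ x => by
    simp [L, Finset.sum_apply]
  by_cases hdis : Disjoint (L '' stdSimplex ℝ (Fin n)) {y : ι → ℝ | ∀ x, ε ≤ y x}
  swap
  · obtain ⟨y, ⟨μ, hμ, rfl⟩, hy⟩ := Set.not_disjoint_iff.1 hdis
    exact ⟨n, pt, μ, hμ.1, hμ.2, fun x => by rw [← hL]; exact hy x⟩
  exfalso
  obtain ⟨f, u, v, hfu, huv, hfv⟩ := geometric_hahn_banach_compact_closed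
    ((convex_stdSimplex ℝ (Fin n)).linear_image L)
    ((isCompact_stdSimplex (𝕜 := ℝ) (Fin n)).image L.continuous_of_finiteDimensional)
    (t := {y : ι → ℝ | ∀ x, ε ≤ y x})
    (fun y hy z hz a b ha hb hab x => by
      have h1 := mul_le_mul_of_nonneg_left (hy x) ha
      have h2 := mul_le_mul_of_nonneg_left (hz x) hb
      have h3 : a * ε + b * ε = ε := by rw [← add_mul, hab, one_mul]
      simp only [Pi.add_apply, Pi.smul_apply, smul_eq_mul]
      linarith)
    (by
      rw [Set.ofPred_forall]
      exact isClosed_iInter fun x => isClosed_le continuous_const (continuous_apply x))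
    hdis
  set c : ι → ℝ := fun x => f (Pi.single x 1) with hc
  have hf : ∀ y, f y = ∑ x, y x * c x := fun y => by
    conv_lhs => rw [pi_eq_sum_univ' y, map_sum]
    refine Finset.sum_congr rfl fun x _ => ?_
    rw [map_smul, smul_eq_mul, hc]
  have hc0 : ∀ x, 0 ≤ c x := by
    intro x
    by_contra hneg
    push Not at hneg
    set s := (v - f fun _ => ε) / c x with hs
    have hv : v < f fun _ => ε := hfv _ fun x => le_rfl
    have hs0 : 0 ≤ s := div_nonneg_of_nonpos (by linarith) hneg.le
    have := hfv ((fun _ => ε) + s • Pi.single x 1) fun y => by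
      have : 0 ≤ s * (Pi.single x (1 : ℝ) : ι → ℝ) y := mul_nonneg hs0 (by
        by_cases hxy : y = x
        · subst hxy; simp
        · simp [hxy])
      simp only [Pi.add_apply, Pi.smul_apply, smul_eq_mul]
      linarith
    rw [map_add, map_smul, smul_eq_mul] at this
    have h2 : s * c x = v - f fun _ => ε := by rw [hs, div_mul_cancel₀ _ hneg.ne]
    change v < (f fun _ => ε) + s * c x at this
    linarith
  have hV0 : ∀ k x, 0 ≤ V k x := fun k x => by simp only [hV]; split_ifs <;> simp
  have hVu : ∀ k, ∑ x, V k x * c x < u := fun k => by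
    rw [← hf]
    refine hfu _ ⟨Pi.single k 1, single_mem_stdSimplex ℝ k, ?_⟩
    funext x
    rw [hL, Finset.sum_eq_single k] <;> simp +contextual
  have hsum : v < ε * ∑ x, c x := by
    have := hfv (fun _ => ε) fun _ => le_rfl
    rwa [hf, ← Finset.mul_sum] at this
  have hn : Nonempty (Fin n) := by
    obtain ⟨x⟩ := hι
    obtain ⟨p, -⟩ := h (Pi.single x 1) (fun y => by
      by_cases hxy : y = x
      · subst hxy; simp
      · simp [hxy]) (by simp)
    exact ⟨(hpt p).choose⟩
  have hcpos : 0 < ∑ x, c x := by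
    obtain ⟨k⟩ := hn
    have h1 : 0 ≤ ∑ x, V k x * c x := Finset.sum_nonneg fun x _ => mul_nonneg (hV0 k x) (hc0 x)
    have h2 := hVu k
    exact pos_of_mul_pos_right (show 0 < ε * ∑ x, c x by linarith) hε.le
  obtain ⟨p, hp⟩ := h (fun x => c x / ∑ x, c x) (fun x => div_nonneg (hc0 x) hcpos.le)
    (by rw [← Finset.sum_div, div_self hcpos.ne'])
  obtain ⟨k, hk⟩ := hpt p
  have h1 : ∑ x, c x / (∑ x, c x) * (if p ∈ S x then 1 else 0) =
      (∑ x, V k x * c x) / ∑ x, c x := by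
    rw [Finset.sum_div]
    refine Finset.sum_congr rfl fun x _ => ?_
    simp only [hV, hk x]
    ring
  rw [h1, le_div_iff₀ hcpos] at hp
  linarith [hVu k]

/-! ### Epsilon-nets -/

/-- Swap the two coordinates or not. -/
def swapIf (β : Type*) (s : Bool) : β × β ≃ β × β :=
  if s then Equiv.prodComm β β else Equiv.refl _

open Classical in
/-- The trace of `U` on a sequence of pairs of points. -/
noncomputable def pairTrace {X : Type*} {N : ℕ} (z : Fin N → X × X) (U : Set X) :
    Fin N → Bool × Bool :=
  fun i => (decide ((z i).1 ∈ U), decide ((z i).2 ∈ U))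

/-- The weight of a pair: pairs whose first point is hit do not count, and those whose second
point only is hit count twice. -/
def pairWeight (t : Bool × Bool) : ℝ :=
  if t.1 then 0 else if t.2 then 2 else 1

open Classical in
/-- If the number of traces on `2N` points is less than `(1 + ε) ^ N`, then some `N` points meet
all members of measure at least `ε`. -/
theorem exists_net {X ι : Type*} [Fintype X] [Fintype ι] {μ : X → ℝ} (hμ : ∀ x, 0 ≤ μ x)
    (hμ1 : ∑ x, μ x = 1) {U : ι → Set X} {ε : ℝ} (hε : 0 ≤ ε)
    (hU : ∀ a, ε ≤ ∑ x, μ x * (if x ∈ U a then 1 else 0)) {N : ℕ} {B : ℝ}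
    (hB : ∀ z : Fin N → X × X,
      (((Finset.univ : Finset ι).image fun a => pairTrace z (U a)).card : ℝ) ≤ B)
    (hlt : B < (1 + ε) ^ N) : ∃ y : Fin N → X, ∀ a, ∃ i, y i ∈ U a := by
  by_contra hcon
  push Not at hcon
  choose f hf using hcon
  set T : (Fin N → X × X) → Finset (Fin N → Bool × Bool) := fun z =>
    (Finset.univ : Finset ι).image fun a => pairTrace z (U a) with hT
  set m : (Fin N → X × X) → ℝ := fun z => ∏ i, (μ (z i).1 * μ (z i).2) with hm
  set φ : (Fin N → Bool × Bool) → ℝ := fun t => ∏ i, pairWeight (t i) with hφ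
  have hm0 : ∀ z, 0 ≤ m z := fun z => Finset.prod_nonneg fun i _ => mul_nonneg (hμ _) (hμ _)
  have hw0 : ∀ t, 0 ≤ pairWeight t := fun t => by unfold pairWeight; split_ifs <;> norm_num
  have hφ0 : ∀ t, 0 ≤ φ t := fun t => Finset.prod_nonneg fun i _ => hw0 _
  have hm1 : ∑ z, m z = 1 := by
    rw [hm]
    simp only
    rw [← Fintype.sum_pow (fun p : X × X => μ p.1 * μ p.2), Fintype.sum_prod_type]
    simp only [← Finset.mul_sum, hμ1, mul_one, one_pow]
  -- the upper bound, by symmetrisation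
  let sw : ∀ (β : Type _), (Fin N → Bool) → (Fin N → β × β) ≃ (Fin N → β × β) :=
    fun β σ => Equiv.piCongrRight fun i => swapIf β (σ i)
  let swB : (Fin N → Bool) → (Fin N → Bool × Bool) ≃ (Fin N → Bool × Bool) :=
    fun σ => Equiv.piCongrRight fun i => swapIf Bool (σ i)
  have hTsw : ∀ σ z, T (sw X σ z) = (T z).image (swB σ) := by
    intro σ z
    simp only [hT, Finset.image_image]
    congr 1
    funext a i
    cases h : σ i <;> simp [sw, swB, pairTrace, swapIf, h]
  have hmsw : ∀ σ z, m (sw X σ z) = m z := by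
    intro σ z
    refine Finset.prod_congr rfl fun i _ => ?_
    cases h : σ i <;> simp [sw, swapIf, h, mul_comm]
  have hφsw : ∀ t, ∑ σ, φ (swB σ t) ≤ 2 ^ N := by
    intro t
    have h1 : ∑ σ, φ (swB σ t) = ∏ i, ∑ s, pairWeight (swapIf Bool s (t i)) := by
      rw [Finset.prod_univ_sum, Fintype.piFinset_univ]
      rfl
    have h2 : ∀ p, ∑ s, pairWeight (swapIf Bool s p) ≤ 2 := by
      rintro ⟨_ | _, _ | _⟩ <;> simp [pairWeight, swapIf]; norm_num
    rw [h1]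
    refine (Finset.prod_le_prod (fun i _ => Finset.sum_nonneg fun s _ => hw0 _)
      fun i _ => h2 _).trans ?_
    simp
  set Φ := ∑ z, m z * ∑ t ∈ T z, φ t with hΦ
  have hup : 2 ^ N * Φ ≤ 2 ^ N * B := by
    calc 2 ^ N * Φ = ∑ _σ : Fin N → Bool, Φ := by simp
      _ = ∑ σ : Fin N → Bool, ∑ z, m z * ∑ t ∈ T z, φ (swB σ t) := by
        refine Finset.sum_congr rfl fun σ _ => ?_
        rw [hΦ, ← (sw X σ).sum_comp]
        refine Finset.sum_congr rfl fun z _ => ?_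
        rw [hmsw, hTsw, Finset.sum_image (fun a _ b _ h => (swB σ).injective h)]
      _ = ∑ z, m z * ∑ t ∈ T z, ∑ σ : Fin N → Bool, φ (swB σ t) := by
        rw [Finset.sum_comm]
        refine Finset.sum_congr rfl fun z _ => ?_
        rw [← Finset.mul_sum, Finset.sum_comm]
      _ ≤ ∑ z, m z * ∑ t ∈ T z, (2 : ℝ) ^ N :=
        Finset.sum_le_sum fun z _ => mul_le_mul_of_nonneg_left
          (Finset.sum_le_sum fun t _ => hφsw t) (hm0 z)
      _ ≤ ∑ z, m z * (2 ^ N * B) :=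
        Finset.sum_le_sum fun z _ => mul_le_mul_of_nonneg_left (by
          rw [Finset.sum_const, nsmul_eq_mul, mul_comm]
          exact mul_le_mul_of_nonneg_left (hB z) (by positivity)) (hm0 z)
      _ = 2 ^ N * B := by rw [← Finset.sum_mul, hm1, one_mul]
  have hup' : Φ ≤ B := le_of_mul_le_mul_left hup (by positivity)
  -- the lower bound
  have hlow : (1 + ε) ^ N ≤ Φ := by
    have hsplit : Φ = ∑ y : Fin N → X, ∑ y' : Fin N → X, (∏ i, μ (y i)) * ((∏ i, μ (y' i)) *
        ∑ t ∈ T (fun i => (y i, y' i)), φ t) := by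
      rw [hΦ, ← (Equiv.arrowProdEquivProdArrow (Fin N) (fun _ => X) (fun _ => X)).symm.sum_comp,
        Fintype.sum_prod_type]
      refine Finset.sum_congr rfl fun y _ => Finset.sum_congr rfl fun y' _ => ?_
      rw [hm, ← mul_assoc, ← Finset.prod_mul_distrib]
      rfl
    have hprob : ∀ y : Fin N → X, (1 + ε) ^ N ≤ ∑ y' : Fin N → X, (∏ i, μ (y' i)) *
        ∑ t ∈ T (fun i => (y i, y' i)), φ t := by
      intro y
      have h1 : (1 + ε) ≤ ∑ x, μ x * (1 + if x ∈ U (f y) then 1 else 0) := by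
        simp only [mul_add, mul_one, Finset.sum_add_distrib, hμ1]
        linarith [hU (f y)]
      refine (pow_le_pow_left₀ (by linarith) h1 N).trans ?_
      rw [Fintype.sum_pow]
      refine Finset.sum_le_sum fun y' _ => ?_
      rw [Finset.prod_mul_distrib]
      refine mul_le_mul_of_nonneg_left ?_ (Finset.prod_nonneg fun i _ => hμ _)
      refine le_trans (le_of_eq ?_) (Finset.single_le_sum (fun t _ => hφ0 t)
        (Finset.mem_image_of_mem (fun a => pairTrace (fun i => (y i, y' i)) (U a))
          (Finset.mem_univ (f y))))
      refine Finset.prod_congr rfl fun i _ => ?_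
      have := hf y i
      by_cases h' : y' i ∈ U (f y) <;> simp [pairTrace, pairWeight, this, h']
      norm_num
    rw [hsplit]
    simp only [← Finset.mul_sum]
    calc (1 + ε) ^ N = ∑ y : Fin N → X, (∏ i, μ (y i)) * (1 + ε) ^ N := by
          rw [← Finset.sum_mul, ← Fintype.sum_pow, hμ1, one_pow, one_mul]
      _ ≤ _ := Finset.sum_le_sum fun y _ => mul_le_mul_of_nonneg_left (hprob y)
          (Finset.prod_nonneg fun i _ => hμ _)
  linarith

/-! ### Counting traces -/

open Classical in
/-- A system without an isolated `3 × 3` bipartite pattern shatters no `64` points, so it has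
polynomially many traces. -/
theorem NoIsolatedBipartite.card_traces_le {P α ι : Type*} [Fintype P] [DecidableEq P] [Nonempty P]
    [Fintype ι] {S : ι → Set α} (hK : NoIsolatedBipartite S) (pt : P → α) :
    ((Finset.univ : Finset ι).image fun x => Finset.univ.filter fun p => pt p ∈ S x).card ≤
      64 * Fintype.card P ^ 63 := by
  set 𝒜 : Finset (Finset P) :=
    (Finset.univ : Finset ι).image fun x => Finset.univ.filter fun p => pt p ∈ S x with h𝒜
  have hvc : 𝒜.vcDim ≤ 63 := by
    refine Finset.sup_le fun s hs => ?_
    rw [Finset.mem_shatterer] at hs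
    by_contra! hcard
    have hle : Fintype.card (Finset (Fin 3 ⊕ Fin 3)) ≤ Fintype.card s := by
      simp only [Fintype.card_finset, Fintype.card_sum, Fintype.card_fin, Fintype.card_coe]
      exact hcard
    obtain ⟨g⟩ := Function.Embedding.nonempty_of_card_le hle
    have hx : ∀ v : Fin 3 ⊕ Fin 3, ∃ x, ∀ A, pt (g A) ∈ S x ↔ v ∈ A := by
      intro v
      obtain ⟨u, hu, hsu⟩ := hs (t := s.filter fun p => ∃ A, (g A : P) = p ∧ v ∈ A)
        (Finset.filter_subset _ _)
      obtain ⟨x, -, rfl⟩ := Finset.mem_image.1 hu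
      refine ⟨x, fun A => ?_⟩
      have h1 := Finset.ext_iff.1 hsu (g A)
      simp only [Finset.mem_inter, Finset.mem_filter, Finset.mem_univ, true_and,
        (g A).2] at h1
      rw [h1]
      refine ⟨?_, fun h => ⟨A, rfl, h⟩⟩
      rintro ⟨A', hA', hv⟩
      rwa [← g.injective (Subtype.ext hA')]
    choose x hx using hx
    exact hK (fun i => x (.inl i)) (fun j => x (.inr j))
      (fun i j => pt (g {.inl i, .inr j}))
      (fun i j k => by rw [hx]; simp [eq_comm]) (fun i j l => by rw [hx]; simp [eq_comm])
  have hpos : 1 ≤ Fintype.card P := Fintype.card_pos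
  calc 𝒜.card ≤ 𝒜.shatterer.card := 𝒜.card_le_card_shatterer
    _ ≤ ∑ k ∈ Finset.Iic 𝒜.vcDim, (Fintype.card P).choose k :=
      Finset.card_shatterer_le_sum_vcDim
    _ ≤ ∑ k ∈ Finset.Iic 63, (Fintype.card P).choose k :=
      Finset.sum_le_sum_of_subset (Finset.Iic_subset_Iic.2 hvc)
    _ ≤ ∑ k ∈ Finset.Iic 63, Fintype.card P ^ 63 := by
      refine Finset.sum_le_sum fun k hk => (Nat.choose_le_pow _ _).trans ?_
      exact Nat.pow_le_pow_right hpos (Finset.mem_Iic.1 hk)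
    _ = 64 * Fintype.card P ^ 63 := by simp

open Classical in
theorem NoIsolatedBipartite.card_pairTraces_le {α ι X : Type*} [Fintype ι] {S : ι → Set α}
    (hK : NoIsolatedBipartite S) (pt : X → α) {N : ℕ} (hN : 0 < N) (z : Fin N → X × X) :
    ((Finset.univ : Finset ι).image fun x => pairTrace z {k | pt k ∈ S x}).card ≤
      64 * (2 * N) ^ 63 := by
  have : Nonempty (Fin N) := ⟨⟨0, hN⟩⟩
  have h := hK.card_traces_le fun p : Fin N × Bool => pt (bif p.2 then (z p.1).2 else (z p.1).1)
  rw [Fintype.card_prod, Fintype.card_fin, Fintype.card_bool, mul_comm N 2] at h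
  refine le_trans ?_ h
  let F : Finset (Fin N × Bool) → Fin N → Bool × Bool := fun A i =>
    (decide ((i, false) ∈ A), decide ((i, true) ∈ A))
  refine (Finset.card_le_card (t := Finset.image F _) ?_).trans Finset.card_image_le
  rw [Finset.image_image]
  refine (Finset.image_congr fun x _ => ?_).le
  funext i
  simp [F, pairTrace]

theorem trace_bound_lt {n : ℕ} (hn : 1 ≤ n) :
    ((64 * (2 * (37 * n ^ 9 * (2048 * n))) ^ 63 : ℕ) : ℝ) <
      (1 + 1 / ((37 * n ^ 9 : ℕ) : ℝ)) ^ (37 * n ^ 9 * (2048 * n)) := by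
  have hm : (0 : ℝ) < ((37 * n ^ 9 : ℕ) : ℝ) := by positivity
  have h2 : (2 : ℝ) ≤ (1 + 1 / ((37 * n ^ 9 : ℕ) : ℝ)) ^ (37 * n ^ 9) := by
    refine le_trans (le_of_eq ?_) (one_add_mul_le_pow
      (le_trans (by norm_num) (div_nonneg zero_le_one hm.le)) (37 * n ^ 9))
    rw [mul_one_div_cancel hm.ne']
    norm_num
  rw [pow_mul]
  refine lt_of_lt_of_le ?_ (pow_le_pow_left₀ (by norm_num) h2 _)
  have hn2 : n ≤ 2 ^ n := Nat.lt_two_pow_self.le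
  have h3 : 2 * (37 * n ^ 9 * (2048 * n)) ≤ 2 ^ (18 + 10 * n) := by
    calc 2 * (37 * n ^ 9 * (2048 * n)) = 151552 * n ^ 10 := by ring
      _ ≤ 2 ^ 18 * (2 ^ n) ^ 10 := Nat.mul_le_mul (by norm_num) (Nat.pow_le_pow_left hn2 10)
      _ = 2 ^ (18 + 10 * n) := by rw [← pow_mul, ← pow_add, mul_comm n]
  have h4 : 64 * (2 * (37 * n ^ 9 * (2048 * n))) ^ 63 < 2 ^ (2048 * n) := by
    calc _ ≤ 2 ^ 6 * (2 ^ (18 + 10 * n)) ^ 63 :=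
        Nat.mul_le_mul (by norm_num) (Nat.pow_le_pow_left h3 63)
      _ = 2 ^ (6 + (18 + 10 * n) * 63) := by rw [← pow_mul, ← pow_add]
      _ < 2 ^ (2048 * n) := Nat.pow_lt_pow_right (by norm_num) (by lia)
  exact_mod_cast h4

/-- Finite systems without an isolated `3 × 3` bipartite pattern have small transversals. -/
theorem NoIsolatedBipartite.exists_transversal {α ι : Type*} [Fintype ι] [Nonempty ι]
    {S : ι → Set α} (hK : NoIsolatedBipartite S) (hne : ∀ x, (S x).Nonempty) {n : ℕ}
    (hn1 : 1 ≤ n) (hn : ∀ t : Finset ι,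
      (∀ x ∈ t, ∀ y ∈ t, x ≠ y → Disjoint (S x) (S y)) → t.card ≤ n) :
    ∃ T : Finset α, T.card ≤ 75776 * n ^ 10 ∧ ∀ x, ∃ p ∈ T, p ∈ S x := by
  classical
  set ε : ℝ := 1 / ((37 * n ^ 9 : ℕ) : ℝ) with hεdef
  have hn0 : (0 : ℝ) < n := by exact_mod_cast hn1
  have hε : 0 < ε := by positivity
  obtain ⟨k, pt, μ, hμ, hμ1, hμε⟩ := exists_fractional_transversal (S := S) hε inferInstance
    fun w hw hw1 => by
      by_contra! hlt
      have h1 := one_le_mul_matching_pow_nine hK hne hw hw1 (fun p => (hlt p).le) hn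
      have h2 : 36 * ε * (n : ℝ) ^ 9 = 36 / 37 := by
        rw [hεdef]
        push_cast
        field_simp
      norm_num [h2] at h1
  obtain ⟨y, hy⟩ := exists_net hμ hμ1 (U := fun x => {k | pt k ∈ S x}) hε.le hμε
    (fun z => Nat.cast_le.2 (hK.card_pairTraces_le pt (N := 37 * n ^ 9 * (2048 * n))
      (by positivity) z)) (trace_bound_lt hn1)
  refine ⟨Finset.univ.image fun i => pt (y i), Finset.card_image_le.trans ?_, fun x => ?_⟩
  · rw [Finset.card_univ, Fintype.card_fin]
    exact le_of_eq (by ring)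
  · obtain ⟨i, hi⟩ := hy x
    exact ⟨_, Finset.mem_image_of_mem _ (Finset.mem_univ i), hi⟩

/-! ### Plane families -/

theorem NonPiercing.noIsolatedBipartite {ℱ : Set (Set Plane)} (hℱ : NonPiercing ℱ)
    (hcl : ∀ F ∈ ℱ, IsClosed F) (hconn : ∀ F ∈ ℱ, IsPreconnected F) :
    NoIsolatedBipartite (fun F : ℱ => (F : Set Plane)) := by
  intro a b q ha hb
  let e := Complex.equivRealProdCLM.toHomeomorph
  have hdiff : ∀ F G : ℱ, F ≠ G → IsPreconnected (e ⁻¹' (F : Set Plane) \ e ⁻¹' (G : Set Plane)) :=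
    fun F G h => by
      rw [← Set.preimage_sdiff, e.isPreconnected_preimage]
      exact (hℱ F F.2 G G.2 fun h' => h (Subtype.ext h')).isPreconnected
  have hab : ∀ i j, a i ≠ b j := fun i j h => by
    obtain ⟨l, hl⟩ := exists_ne j
    have h1 : q i l ∈ (a i : Set Plane) := (ha i l i).2 rfl
    rw [h] at h1
    exact hl ((hb i l j).1 h1)
  refine false_of_isolated_bipartite (A := fun i => e ⁻¹' (a i : Set Plane))
    (B := fun j => e ⁻¹' (b j : Set Plane)) (q := fun i j => e.symm (q i j))
    (fun i => (hcl _ (a i).2).preimage e.continuous)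
    (fun j => (hcl _ (b j).2).preimage e.continuous)
    (fun i => e.isPreconnected_preimage.2 (hconn _ (a i).2))
    (fun j => e.isPreconnected_preimage.2 (hconn _ (b j).2))
    (fun i k hik => hdiff _ _ fun h => hik ?_) (fun j l hjl => hdiff _ _ fun h => hjl ?_)
    (fun i j => hdiff _ _ (hab i j)) (fun i j => hdiff _ _ (hab i j).symm)
    (fun i j k => ?_) (fun i j l => ?_)
  · exact (ha i 0 k).1 (h ▸ (ha i 0 i).2 rfl)
  · exact (hb 0 j l).1 (h ▸ (hb 0 j j).2 rfl)
  · simpa using ha i j k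
  · simpa using hb i j l

/-- There exists a constant `C > 0` such that every finite non-piercing family `ℱ` of
regions in general position satisfies `τ(ℱ) ≤ C · ν(ℱ)^11`. -/
theorem transversal_le_const_mul_matching_pow_eleven :
    ∃ C : ℝ, 0 < C ∧ ∀ ℱ : Set (Set Plane), ℱ.Finite →
      (∀ F ∈ ℱ, IsRegion F) → GeneralPosition ℱ → NonPiercing ℱ →
      (transversalNumber ℱ : ℝ) ≤ C * (matchingNumber ℱ : ℝ) ^ 11 := by
  refine ⟨75776, by norm_num, fun ℱ hfin hreg _ hnp => ?_⟩
  obtain rfl | ⟨F₀, hF₀⟩ := ℱ.eq_empty_or_nonempty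
  · have : transversalNumber ∅ ≤ 0 := Nat.sInf_le ⟨∅, rfl, by simp⟩
    rw [Nat.le_zero.1 this, Nat.cast_zero]
    positivity
  have := hfin.fintype
  have : Nonempty ℱ := ⟨⟨F₀, hF₀⟩⟩
  have hmatch : ∀ 𝒢 : Finset (Set Plane), ↑𝒢 ⊆ ℱ → (𝒢 : Set (Set Plane)).Pairwise Disjoint →
      𝒢.card ≤ matchingNumber ℱ := fun 𝒢 h𝒢 hd =>
    le_csSup ⟨hfin.toFinset.card, by
      rintro _ ⟨𝒢, h𝒢, rfl, -⟩
      exact Finset.card_le_card fun F hF => hfin.mem_toFinset.2 (h𝒢 hF)⟩ ⟨𝒢, h𝒢, rfl, hd⟩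
  have hn1 : 1 ≤ matchingNumber ℱ := hmatch {F₀} (by simpa using hF₀) (by simp)
  have hK := hnp.noIsolatedBipartite (fun F hF => (hreg F hF).1.isClosed)
    fun F hF => (hreg F hF).2.1.isPreconnected
  obtain ⟨T, hT, hmeet⟩ := hK.exists_transversal (fun F => (hreg F F.2).2.1.nonempty) hn1
    fun t ht => by
      rw [← Finset.card_map (Function.Embedding.subtype (· ∈ ℱ))]
      refine hmatch _ (fun F hF => ?_) fun F hF G hG hFG => ?_
      · obtain ⟨F, -, rfl⟩ := Finset.mem_map.1 hF
        exact F.2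
      · obtain ⟨F, hFt, rfl⟩ := Finset.mem_map.1 hF
        obtain ⟨G, hGt, rfl⟩ := Finset.mem_map.1 hG
        exact ht F hFt G hGt fun h => hFG (h ▸ rfl)
  have hτ : transversalNumber ℱ ≤ 75776 * matchingNumber ℱ ^ 11 :=
    calc transversalNumber ℱ ≤ T.card := Nat.sInf_le ⟨T, rfl, fun F hF => hmeet ⟨F, hF⟩⟩
      _ ≤ 75776 * matchingNumber ℱ ^ 10 := hT
      _ ≤ 75776 * matchingNumber ℱ ^ 11 :=
        Nat.mul_le_mul_left _ (Nat.pow_le_pow_right hn1 (by norm_num))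
  exact_mod_cast hτ
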